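/- arXiv:2605.31269 — 5 statements merged into one kernel-verified Lean document; each statement's English description precedes it below -/
import Mathlib

section
/- Let τ be a relational vocabulary, φ a ∀D(τ)-formula, A a τ-structure with universe A, B a substructure of A with universe B ⊆ A, and T a team over A. If A ⊨_T φ, then B ⊨_{T↾B} φ. -/
/-! Core definitions: team semantics for dependence logic over a relational vocabulary. -/

/-- A structure for a relational vocabulary: `σ` is the type of relation symbols,
`ar` gives their arities, `A` is the universe. -/
structure DepStr (σ : Type) (ar : σ → ℕ) (A : Type) where
  rel : ∀ r : σ, (Fin (ar r) → A) → Prop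

/-- Formulas of dependence logic (in negation normal form), with free variables
of type `V`; quantifiers extend the variable type by one fresh variable (`Option`). -/
inductive DepFormula (σ : Type) (ar : σ → ℕ) : Type → Type 1 where
  | rel {V : Type} (r : σ) (ts : Fin (ar r) → V) : DepFormula σ ar V
  | nrel {V : Type} (r : σ) (ts : Fin (ar r) → V) : DepFormula σ ar V
  | eq {V : Type} (x y : V) : DepFormula σ ar V
  | neq {V : Type} (x y : V) : DepFormula σ ar V
  | dep {V : Type} (m : ℕ) (ys : Fin m → V) (z : V) : DepFormula σ ar V
  | and {V : Type} (φ ψ : DepFormula σ ar V) : DepFormula σ ar V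
  | or {V : Type} (φ ψ : DepFormula σ ar V) : DepFormula σ ar V
  | all {V : Type} (φ : DepFormula σ ar (Option V)) : DepFormula σ ar V
  | ex {V : Type} (φ : DepFormula σ ar (Option V)) : DepFormula σ ar V

/-- Team semantics: `DepSat M V φ T` says that the team `T` (a set of assignments
`V → A`) satisfies `φ` in the structure `M`. -/
def DepSat {σ : Type} {ar : σ → ℕ} {A : Type} (M : DepStr σ ar A) :
    (V : Type) → DepFormula σ ar V → Set (V → A) → Prop
  | _, .rel r ts, T => ∀ s ∈ T, M.rel r fun i => s (ts i)
  | _, .nrel r ts, T => ∀ s ∈ T, ¬ M.rel r fun i => s (ts i)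
  | _, .eq x y, T => ∀ s ∈ T, s x = s y
  | _, .neq x y, T => ∀ s ∈ T, s x ≠ s y
  | _, .dep _ ys z, T => ∀ s₁ ∈ T, ∀ s₂ ∈ T, (∀ i, s₁ (ys i) = s₂ (ys i)) → s₁ z = s₂ z
  | V, .and φ ψ, T => DepSat M V φ T ∧ DepSat M V ψ T
  | V, .or φ ψ, T => ∃ T₁ T₂, T = T₁ ∪ T₂ ∧ DepSat M V φ T₁ ∧ DepSat M V ψ T₂
  | V, .all φ, T => DepSat M (Option V) φ {s | (fun v => s (some v)) ∈ T}
  | V, .ex φ, T => ∃ f : (V → A) → A,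
      DepSat M (Option V) φ {s | ∃ t ∈ T, s = fun o => Option.elim o (f t) t}

/-- The `∃`-free (universal) fragment `∀D`. -/
def DepFormula.noEx {σ : Type} {ar : σ → ℕ} : (V : Type) → DepFormula σ ar V → Prop
  | _, .ex _ => False
  | V, .all φ => DepFormula.noEx (Option V) φ
  | V, .and φ ψ => DepFormula.noEx V φ ∧ DepFormula.noEx V ψ
  | V, .or φ ψ => DepFormula.noEx V φ ∧ DepFormula.noEx V ψ
  | _, _ => True

/-- The quantifier-free fragment `DQF`. -/
def DepFormula.isQF {σ : Type} {ar : σ → ℕ} : (V : Type) → DepFormula σ ar V → Prop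
  | _, .ex _ => False
  | _, .all _ => False
  | V, .and φ ψ => DepFormula.isQF V φ ∧ DepFormula.isQF V ψ
  | V, .or φ ψ => DepFormula.isQF V φ ∧ DepFormula.isQF V ψ
  | _, _ => True

/-- The dependence-atom-free (first-order) fragment. -/
def DepFormula.noDep {σ : Type} {ar : σ → ℕ} : (V : Type) → DepFormula σ ar V → Prop
  | _, .dep _ _ _ => False
  | V, .and φ ψ => DepFormula.noDep V φ ∧ DepFormula.noDep V ψ
  | V, .or φ ψ => DepFormula.noDep V φ ∧ DepFormula.noDep V ψ
  | V, .all φ => DepFormula.noDep (Option V) φ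
  | V, .ex φ => DepFormula.noDep (Option V) φ
  | _, _ => True

/-- Induced substructure on a subset `B` of the universe (relational vocabulary). -/
def DepStr.sub {σ : Type} {ar : σ → ℕ} {A : Type} (M : DepStr σ ar A) (B : Set A) :
    DepStr σ ar B :=
  ⟨fun r v => M.rel r fun i => (v i : A)⟩

/-- Restriction `T ↾ B` of a team to assignments taking values in `B`. -/
def teamRestrict {V A : Type} (T : Set (V → A)) (B : Set A) : Set (V → B) :=
  {t | (fun v => (t v : A)) ∈ T}


/-- First-order formulas over a relational vocabulary. -/
inductive FOForm (σ : Type) (ar : σ → ℕ) : Type → Type 1 where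
  | rel {V : Type} (r : σ) (ts : Fin (ar r) → V) : FOForm σ ar V
  | eq {V : Type} (x y : V) : FOForm σ ar V
  | not {V : Type} (φ : FOForm σ ar V) : FOForm σ ar V
  | and {V : Type} (φ ψ : FOForm σ ar V) : FOForm σ ar V
  | or {V : Type} (φ ψ : FOForm σ ar V) : FOForm σ ar V
  | all {V : Type} (φ : FOForm σ ar (Option V)) : FOForm σ ar V
  | ex {V : Type} (φ : FOForm σ ar (Option V)) : FOForm σ ar V

/-- Tarskian satisfaction of a first-order formula by a single assignment. -/
def FOSat {σ : Type} {ar : σ → ℕ} {A : Type} (M : DepStr σ ar A) :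
    (V : Type) → FOForm σ ar V → (V → A) → Prop
  | _, .rel r ts, s => M.rel r fun i => s (ts i)
  | _, .eq x y, s => s x = s y
  | V, .not φ, s => ¬ FOSat M V φ s
  | V, .and φ ψ, s => FOSat M V φ s ∧ FOSat M V ψ s
  | V, .or φ ψ, s => FOSat M V φ s ∨ FOSat M V ψ s
  | V, .all φ, s => ∀ a : A, FOSat M (Option V) φ (fun o => Option.elim o a s)
  | V, .ex φ, s => ∃ a : A, FOSat M (Option V) φ (fun o => Option.elim o a s)

/-- A first-order sentence (no free variables) is true in `M`. -/
def FOTrue {σ : Type} {ar : σ → ℕ} {A : Type} (M : DepStr σ ar A)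
    (φ : FOForm σ ar Empty) : Prop :=
  FOSat M Empty φ (fun e => e.elim)

/-- Quantifier-free first-order formulas. -/
def FOForm.isQF {σ : Type} {ar : σ → ℕ} : (V : Type) → FOForm σ ar V → Prop
  | _, .all _ => False
  | _, .ex _ => False
  | V, .not φ => FOForm.isQF V φ
  | V, .and φ ψ => FOForm.isQF V φ ∧ FOForm.isQF V ψ
  | V, .or φ ψ => FOForm.isQF V φ ∧ FOForm.isQF V ψ
  | _, _ => True

/-- Universal first-order formulas: a block of `∀` followed by a quantifier-free formula. -/
inductive FOForm.IsUniversal {σ : Type} {ar : σ → ℕ} : {V : Type} → FOForm σ ar V → Prop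
  | of_qf {V : Type} (φ : FOForm σ ar V) : FOForm.isQF V φ → FOForm.IsUniversal φ
  | all {V : Type} (φ : FOForm σ ar (Option V)) :
      FOForm.IsUniversal φ → FOForm.IsUniversal (.all φ)

/-- `OptIter l V` adds `l` fresh variables to the variable type `V`. -/
def OptIter : ℕ → Type → Type
  | 0, V => V
  | l+1, V => Option (OptIter l V)

/-- The embedding of the old variables into `OptIter l V`. -/
def optEmbed : (l : ℕ) → {V : Type} → V → OptIter l V
  | 0, _, v => v
  | l+1, _, v => some (optEmbed l v)

/-- Prefix a first-order formula with `l` universal quantifiers. -/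
def FOForm.allIter {σ : Type} {ar : σ → ℕ} :
    (l : ℕ) → {V : Type} → FOForm σ ar (OptIter l V) → FOForm σ ar V
  | 0, _, φ => φ
  | l+1, _, φ => FOForm.allIter l (.all φ)

/-- Prefix a dependence formula with `l` universal quantifiers. -/
def DepFormula.allIter {σ : Type} {ar : σ → ℕ} :
    (l : ℕ) → {V : Type} → DepFormula σ ar (OptIter l V) → DepFormula σ ar V
  | 0, _, φ => φ
  | l+1, _, φ => DepFormula.allIter l (.all φ)

/-- The iterated duplicate team `T⟨y⃗ ↦ A⟩`: all extensions of members of `T`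
to the `l` new variables. -/
def dupIter {A : Type} (l : ℕ) {V : Type} (T : Set (V → A)) : Set (OptIter l V → A) :=
  {s | (fun v => s (optEmbed l v)) ∈ T}

/-- The vocabulary `τ ∪ {R}` with `R` a fresh `n`-ary relation symbol. -/
def exAr {σ : Type} (ar : σ → ℕ) (n : ℕ) : σ ⊕ Unit → ℕ :=
  Sum.elim ar fun _ => n

/-- The expansion `(A, Rel(T))` of a structure by a team, interpreting
the fresh symbol `R` as the `n`-ary relation determined by the team `T`. -/
def expandR {σ : Type} {ar : σ → ℕ} {A : Type} {n : ℕ}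
    (M : DepStr σ ar A) (T : Set (Fin n → A)) : DepStr (σ ⊕ Unit) (exAr ar n) A :=
  ⟨fun r => match r with
    | .inl r => M.rel r
    | .inr _ => fun v => v ∈ T⟩

/-- `ψ` rewrites the dependence formula `φ(x₁,…,xₙ)`:  `A ⊨_T φ  ↔  (A, Rel(T)) ⊨ ψ`. -/
def Rewrites {σ : Type} {ar : σ → ℕ} {n : ℕ}
    (ψ : FOForm (σ ⊕ Unit) (exAr ar n) Empty) (φ : DepFormula σ ar (Fin n)) : Prop :=
  ∀ (A : Type) [Nonempty A] (M : DepStr σ ar A) (T : Set (Fin n → A)),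
    DepSat M (Fin n) φ T ↔ FOTrue (expandR M T) ψ

/-- `φ` is first-order rewritable. -/
def FORewritable {σ : Type} {ar : σ → ℕ} {n : ℕ} (φ : DepFormula σ ar (Fin n)) : Prop :=
  ∃ ψ : FOForm (σ ⊕ Unit) (exAr ar n) Empty, Rewrites ψ φ

/-- `φ` is rewritable to a universal first-order sentence. -/
def UnivRewritable {σ : Type} {ar : σ → ℕ} {n : ℕ} (φ : DepFormula σ ar (Fin n)) : Prop :=
  ∃ ψ : FOForm (σ ⊕ Unit) (exAr ar n) Empty, ψ.IsUniversal ∧ Rewrites ψ φ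

/-- `φ` is `k`-coherent: a team satisfies `φ` iff all its subteams with at
most `k` elements do. -/
def KCoherent {σ : Type} {ar : σ → ℕ} {V : Type} (k : ℕ) (φ : DepFormula σ ar V) : Prop :=
  ∀ (A : Type) [Nonempty A] (M : DepStr σ ar A) (T : Set (V → A)),
    DepSat M V φ T ↔ ∀ S ⊆ T, S.Finite → S.ncard ≤ k → DepSat M V φ S

/-- `φ` is coherent: `k`-coherent for some `k ≥ 1`. -/
def Coherent {σ : Type} {ar : σ → ℕ} {V : Type} (φ : DepFormula σ ar V) : Prop :=
  ∃ k : ℕ, 1 ≤ k ∧ KCoherent k φ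

/-- `φ` is `k`-coherent in the finite. -/
def KCoherentFin {σ : Type} {ar : σ → ℕ} {V : Type} (k : ℕ) (φ : DepFormula σ ar V) : Prop :=
  ∀ (A : Type) [Nonempty A] [Finite A] (M : DepStr σ ar A) (T : Set (V → A)),
    DepSat M V φ T ↔ ∀ S ⊆ T, S.Finite → S.ncard ≤ k → DepSat M V φ S

/-- Strong `k`-coherence of `∀y₁…∀y_l β` (with `β` quantifier-free): a team `T`
satisfies `∀y⃗ β` iff every at-most-`k`-element subteam of the duplicated team
`T⟨y⃗ ↦ A⟩` satisfies `β`. -/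
def StronglyKCoherent {σ : Type} {ar : σ → ℕ} (k : ℕ) (n l : ℕ)
    (β : DepFormula σ ar (OptIter l (Fin n))) : Prop :=
  ∀ (A : Type) [Nonempty A] (M : DepStr σ ar A) (T : Set (Fin n → A)),
    DepSat M (Fin n) (DepFormula.allIter l β) T ↔
      ∀ S ⊆ dupIter l T, S.Finite → S.ncard ≤ k → DepSat M (OptIter l (Fin n)) β S

/-- Strong `k`-coherence in the finite. -/
def StronglyKCoherentFin {σ : Type} {ar : σ → ℕ} (k : ℕ) (n l : ℕ)
    (β : DepFormula σ ar (OptIter l (Fin n))) : Prop :=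
  ∀ (A : Type) [Nonempty A] [Finite A] (M : DepStr σ ar A) (T : Set (Fin n → A)),
    DepSat M (Fin n) (DepFormula.allIter l β) T ↔
      ∀ S ⊆ dupIter l T, S.Finite → S.ncard ≤ k → DepSat M (OptIter l (Fin n)) β S

/-- If `φ` is an `∃`-free dependence formula, `M ⊨_T φ`, and `B`
is (the universe of) a substructure of `M`, then `B ⊨_{T↾B} φ`. -/
theorem stmt0 {σ : Type} {ar : σ → ℕ} {A : Type} (M : DepStr σ ar A) (B : Set A)
    {V : Type} (φ : DepFormula σ ar V) (hφ : DepFormula.noEx V φ)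
    (T : Set (V → A)) (hT : DepSat M V φ T) :
    DepSat (M.sub B) V φ (teamRestrict T B) := by
  induction φ with
  | rel r ts =>
    simp only [DepSat] at hT ⊢
    intro s hs
    exact hT _ hs
  | nrel r ts =>
    simp only [DepSat] at hT ⊢
    intro s hs
    exact hT _ hs
  | eq x y =>
    simp only [DepSat] at hT ⊢
    intro s hs
    exact Subtype.ext (hT _ hs)
  | neq x y =>
    simp only [DepSat] at hT ⊢
    intro s hs h
    exact hT _ hs (congrArg Subtype.val h)
  | dep m ys z =>
    simp only [DepSat] at hT ⊢
    intro s hs t ht h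
    exact Subtype.ext (hT _ hs _ ht fun i => congrArg Subtype.val (h i))
  | and φ ψ ih1 ih2 =>
    simp only [DepSat, DepFormula.noEx] at hT hφ ⊢
    exact ⟨ih1 hφ.1 T hT.1, ih2 hφ.2 T hT.2⟩
  | or φ ψ ih1 ih2 =>
    simp only [DepSat, DepFormula.noEx] at hT hφ ⊢
    obtain ⟨T₁, T₂, rfl, h1, h2⟩ := hT
    exact ⟨teamRestrict T₁ B, teamRestrict T₂ B, rfl, ih1 hφ.1 _ h1, ih2 hφ.2 _ h2⟩
  | all φ ih =>
    simp only [DepSat, DepFormula.noEx] at hT hφ ⊢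
    exact ih hφ _ hT
  | ex φ ih =>
    simp only [DepFormula.noEx] at hφ
end

section
/- Every ∀D(τ)-formula φ(x₁,…,xₙ) is SNP-rewritable: there exist finitely many fresh relation symbols S₁,…,S_m and a universal first-order sentence ∀x⃗θ (θ quantifier-free) over the vocabulary τ ∪ {R, S₁,…,S_m}, with R a fresh n-ary relation symbol, such that for every τ-structure A and every team T with domain {x₁,…,xₙ}: A ⊨_T φ if and only if the structure (A, Rel(T)) admits an expansion by interpretations of S₁,…,S_m satisfying ∀x⃗θ, where Rel(T) = {(s(x₁),…,s(xₙ)) : s ∈ T}. -/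
/-- The vocabulary `τ ∪ {R} ∪ {S₁,…,S_{m'}}`. -/
def exAr2 {σ : Type} (ar : σ → ℕ) (n : ℕ) {m' : ℕ} (arS : Fin m' → ℕ) :
    (σ ⊕ Unit) ⊕ Fin m' → ℕ :=
  Sum.elim (Sum.elim ar fun _ => n) arS

/-- The expansion `(A, Rel(T), S⃗)` of a structure by a team and interpretations
of the extra relation symbols. -/
def expandRS {σ : Type} {ar : σ → ℕ} {A : Type} {n : ℕ} {m' : ℕ} {arS : Fin m' → ℕ}
    (M : DepStr σ ar A) (T : Set (Fin n → A))
    (Ss : ∀ i : Fin m', (Fin (arS i) → A) → Prop) :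
    DepStr ((σ ⊕ Unit) ⊕ Fin m') (exAr2 ar n arS) A :=
  ⟨fun r => match r with
    | .inl (.inl r) => M.rel r
    | .inl (.inr _) => fun v => v ∈ T
    | .inr i => Ss i⟩

/-- Quantifier-free formulas with a fixed variable type. -/
inductive QFm (σ : Type) (ar : σ → ℕ) (V : Type) : Type where
  | rel (r : σ) (ts : Fin (ar r) → V) : QFm σ ar V
  | eq (x y : V) : QFm σ ar V
  | not (φ : QFm σ ar V) : QFm σ ar V
  | and (φ ψ : QFm σ ar V) : QFm σ ar V
  | or (φ ψ : QFm σ ar V) : QFm σ ar V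

namespace QFm

def ev {σ : Type} {ar : σ → ℕ} {A V : Type} (M : DepStr σ ar A) (s : V → A) :
    QFm σ ar V → Prop
  | .rel r ts => M.rel r fun i => s (ts i)
  | .eq x y => s x = s y
  | .not φ => ¬ ev M s φ
  | .and φ ψ => ev M s φ ∧ ev M s ψ
  | .or φ ψ => ev M s φ ∨ ev M s ψ

/-- Translate symbols and variables. -/
def tr {σ₁ σ₂ : Type} {ar₁ : σ₁ → ℕ} {ar₂ : σ₂ → ℕ} {V₁ V₂ : Type}
    (h : ∀ r, (Fin (ar₁ r) → V₂) → QFm σ₂ ar₂ V₂) (g : V₁ → V₂) :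
    QFm σ₁ ar₁ V₁ → QFm σ₂ ar₂ V₂
  | .rel r ts => h r fun i => g (ts i)
  | .eq x y => .eq (g x) (g y)
  | .not φ => .not (tr h g φ)
  | .and φ ψ => .and (tr h g φ) (tr h g ψ)
  | .or φ ψ => .or (tr h g φ) (tr h g ψ)

theorem ev_tr {σ₁ σ₂ : Type} {ar₁ : σ₁ → ℕ} {ar₂ : σ₂ → ℕ} {V₁ V₂ A : Type}
    (h : ∀ r, (Fin (ar₁ r) → V₂) → QFm σ₂ ar₂ V₂) (g : V₁ → V₂)
    (M₁ : DepStr σ₁ ar₁ A) (M₂ : DepStr σ₂ ar₂ A) (s : V₂ → A)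
    (H : ∀ r ts, ev M₂ s (h r ts) ↔ M₁.rel r fun i => s (ts i)) (θ : QFm σ₁ ar₁ V₁) :
    ev M₂ s (tr h g θ) ↔ ev M₁ (fun v => s (g v)) θ := by
  induction θ with
  | rel r ts => simp only [tr, ev, H]
  | eq x y => simp only [tr, ev]
  | not φ ih => simp only [tr, ev, ih]
  | and φ ψ ih1 ih2 => simp only [tr, ev, ih1, ih2]
  | or φ ψ ih1 ih2 => simp only [tr, ev, ih1, ih2]

def toFO {σ : Type} {ar : σ → ℕ} {V : Type} : QFm σ ar V → FOForm σ ar V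
  | .rel r ts => .rel r ts
  | .eq x y => .eq x y
  | .not φ => .not (toFO φ)
  | .and φ ψ => .and (toFO φ) (toFO ψ)
  | .or φ ψ => .or (toFO φ) (toFO ψ)

theorem toFO_qf {σ : Type} {ar : σ → ℕ} {V : Type} (θ : QFm σ ar V) :
    FOForm.isQF V θ.toFO := by
  induction θ with
  | rel r ts => simp only [toFO, FOForm.isQF]
  | eq x y => simp only [toFO, FOForm.isQF]
  | not φ ih => simpa only [toFO, FOForm.isQF] using ih
  | and φ ψ ih1 ih2 => exact ⟨ih1, ih2⟩
  | or φ ψ ih1 ih2 => exact ⟨ih1, ih2⟩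

theorem sat_toFO {σ : Type} {ar : σ → ℕ} {V A : Type} (M : DepStr σ ar A) (s : V → A)
    (θ : QFm σ ar V) : FOSat M V θ.toFO s ↔ ev M s θ := by
  induction θ with
  | rel r ts => simp only [toFO, FOSat, ev]
  | eq x y => simp only [toFO, FOSat, ev]
  | not φ ih => simp only [toFO, FOSat, ev, ih]
  | and φ ψ ih1 ih2 => simp only [toFO, FOSat, ev, ih1, ih2]
  | or φ ψ ih1 ih2 => simp only [toFO, FOSat, ev, ih1, ih2]

/-- `⋀ xᵢ = yᵢ → base`. -/
def impEqs {σ : Type} {ar : σ → ℕ} {V : Type} (base : QFm σ ar V) : List (V × V) → QFm σ ar V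
  | [] => base
  | p :: l => .or (.not (.eq p.1 p.2)) (impEqs base l)

theorem ev_impEqs {σ : Type} {ar : σ → ℕ} {V A : Type} (M : DepStr σ ar A) (s : V → A)
    (base : QFm σ ar V) (l : List (V × V)) :
    ev M s (impEqs base l) ↔ ((∀ p ∈ l, s p.1 = s p.2) → ev M s base) := by
  induction l with
  | nil => simp [impEqs]
  | cons p l ih =>
    simp only [impEqs, ev, ih, List.forall_mem_cons]
    tauto

end QFm

/-- Vocabulary with team symbol and extra symbols indexed by `I`. -/
def gAr {σ : Type} (ar : σ → ℕ) (k : ℕ) {I : Type} (arI : I → ℕ) : (σ ⊕ Unit) ⊕ I → ℕ :=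
  Sum.elim (Sum.elim ar fun _ => k) arI

def gExp {σ : Type} {ar : σ → ℕ} {A : Type} {k : ℕ} {I : Type} {arI : I → ℕ}
    (M : DepStr σ ar A) (T : Set (Fin k → A)) (Ss : ∀ i : I, (Fin (arI i) → A) → Prop) :
    DepStr ((σ ⊕ Unit) ⊕ I) (gAr ar k arI) A :=
  ⟨fun r => match r with
    | .inl (.inl r) => M.rel r
    | .inl (.inr _) => fun v => v ∈ T
    | .inr i => Ss i⟩

def SNPDef {σ : Type} (ar : σ → ℕ) (k : ℕ)
    (P : ∀ A : Type, DepStr σ ar A → Set (Fin k → A) → Prop) : Prop :=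
  ∃ (I : Type) (_ : Finite I) (arI : I → ℕ) (W : Type) (_ : Finite W)
    (θ : QFm ((σ ⊕ Unit) ⊕ I) (gAr ar k arI) W),
    ∀ (A : Type) [Nonempty A] (M : DepStr σ ar A) (T : Set (Fin k → A)),
      P A M T ↔ ∃ Ss : ∀ i : I, (Fin (arI i) → A) → Prop,
        ∀ w : W → A, QFm.ev (gExp M T Ss) w θ

/-- Symbol translation fixing the base vocabulary. -/
def symTr {σ : Type} {ar : σ → ℕ} {k k' : ℕ} {I J : Type} {arI : I → ℕ} {arJ : J → ℕ} {V : Type}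
    (hR : (Fin k → V) → QFm ((σ ⊕ Unit) ⊕ J) (gAr ar k' arJ) V)
    (hS : ∀ i : I, (Fin (arI i) → V) → QFm ((σ ⊕ Unit) ⊕ J) (gAr ar k' arJ) V) :
    ∀ r : (σ ⊕ Unit) ⊕ I, (Fin (gAr ar k arI r) → V) → QFm ((σ ⊕ Unit) ⊕ J) (gAr ar k' arJ) V
  | .inl (.inl r), ts => .rel (.inl (.inl r)) ts
  | .inl (.inr _), ts => hR ts
  | .inr i, ts => hS i ts

theorem ev_symTr {σ : Type} {ar : σ → ℕ} {k k' : ℕ} {I J : Type} {arI : I → ℕ} {arJ : J → ℕ}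
    {V W A : Type} (M : DepStr σ ar A) (T : Set (Fin k → A)) (T' : Set (Fin k' → A))
    (Ss : ∀ i : I, (Fin (arI i) → A) → Prop) (Ss' : ∀ i : J, (Fin (arJ i) → A) → Prop)
    (hR : (Fin k → V) → QFm ((σ ⊕ Unit) ⊕ J) (gAr ar k' arJ) V)
    (hS : ∀ i : I, (Fin (arI i) → V) → QFm ((σ ⊕ Unit) ⊕ J) (gAr ar k' arJ) V)
    (g : W → V) (s : V → A)
    (HR : ∀ ts, QFm.ev (gExp M T' Ss') s (hR ts) ↔ (fun i => s (ts i)) ∈ T)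
    (HS : ∀ i ts, QFm.ev (gExp M T' Ss') s (hS i ts) ↔ Ss i (fun i => s (ts i)))
    (θ : QFm ((σ ⊕ Unit) ⊕ I) (gAr ar k arI) W) :
    QFm.ev (gExp M T' Ss') s (QFm.tr (symTr hR hS) g θ) ↔
      QFm.ev (gExp M T Ss) (fun v => s (g v)) θ := by
  apply QFm.ev_tr
  rintro ((r | u) | i) ts
  · exact Iff.rfl
  · exact HR ts
  · exact HS i ts

/-- The team atom. -/
def Ratom {σ : Type} {ar : σ → ℕ} {k : ℕ} {I : Type} {arI : I → ℕ} {V : Type}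
    (ts : Fin k → V) : QFm ((σ ⊕ Unit) ⊕ I) (gAr ar k arI) V := .rel (.inl (.inr ())) ts

def Satom {σ : Type} {ar : σ → ℕ} {k : ℕ} {I : Type} {arI : I → ℕ} {V : Type} (i : I)
    (ts : Fin (arI i) → V) : QFm ((σ ⊕ Unit) ⊕ I) (gAr ar k arI) V := .rel (.inr i) ts

theorem ev_Ratom {σ : Type} {ar : σ → ℕ} {k : ℕ} {I : Type} {arI : I → ℕ} {V A : Type}
    (M : DepStr σ ar A) (T : Set (Fin k → A)) (Ss : ∀ i : I, (Fin (arI i) → A) → Prop)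
    (ts : Fin k → V) (s : V → A) :
    QFm.ev (gExp M T Ss) s (Ratom ts) ↔ (fun i => s (ts i)) ∈ T := Iff.rfl

theorem ev_Satom {σ : Type} {ar : σ → ℕ} {k : ℕ} {I : Type} {arI : I → ℕ} {V A : Type}
    (M : DepStr σ ar A) (T : Set (Fin k → A)) (Ss : ∀ i : I, (Fin (arI i) → A) → Prop)
    (i : I) (ts : Fin (arI i) → V) (s : V → A) :
    QFm.ev (gExp M T Ss) s (Satom i ts) ↔ Ss i (fun i => s (ts i)) := Iff.rfl

/-- Universal properties without additional symbols. -/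
theorem SNPDef.of_qf {σ : Type} {ar : σ → ℕ} {k : ℕ} {W : Type} [Finite W]
    (P : ∀ A : Type, DepStr σ ar A → Set (Fin k → A) → Prop)
    (θ : QFm ((σ ⊕ Unit) ⊕ Empty) (gAr ar k (fun e : Empty => e.elim)) W)
    (h : ∀ (A : Type) (M : DepStr σ ar A) (T : Set (Fin k → A)) Ss,
      P A M T ↔ ∀ w : W → A, QFm.ev (gExp M T Ss) w θ) : SNPDef ar k P := by
  refine ⟨Empty, inferInstance, _, W, inferInstance, θ, fun A _ M T => ?_⟩
  constructor
  · intro hp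
    exact ⟨fun e => e.elim, (h A M T _).1 hp⟩
  · rintro ⟨Ss, hs⟩
    exact (h A M T Ss).2 hs

theorem SNPDef.and {σ : Type} {ar : σ → ℕ} {k : ℕ}
    {P Q : ∀ A : Type, DepStr σ ar A → Set (Fin k → A) → Prop}
    (hP : SNPDef ar k P) (hQ : SNPDef ar k Q) :
    SNPDef ar k (fun A M T => P A M T ∧ Q A M T) := by
  obtain ⟨I, _, arI, W, _, θ, h⟩ := hP
  obtain ⟨J, _, arJ, U, _, η, h'⟩ := hQ
  refine ⟨I ⊕ J, inferInstance, Sum.elim arI arJ, W ⊕ U, inferInstance,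
    .and (QFm.tr (symTr Ratom (fun i ts => Satom (Sum.inl i) ts)) Sum.inl θ)
      (QFm.tr (symTr Ratom (fun i ts => Satom (Sum.inr i) ts)) Sum.inr η), ?_⟩
  intro A _ M T
  have key : ∀ (Ss : ∀ i : I ⊕ J, (Fin (Sum.elim arI arJ i) → A) → Prop) (w : W ⊕ U → A),
      QFm.ev (gExp M T Ss) w
        (.and (QFm.tr (symTr Ratom (fun i ts => Satom (Sum.inl i) ts)) Sum.inl θ)
          (QFm.tr (symTr Ratom (fun i ts => Satom (Sum.inr i) ts)) Sum.inr η)) ↔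
      QFm.ev (gExp M T (fun i => Ss (Sum.inl i))) (fun v => w (Sum.inl v)) θ ∧
      QFm.ev (gExp M T (fun i => Ss (Sum.inr i))) (fun v => w (Sum.inr v)) η := by
    intro Ss w
    refine and_congr ?_ ?_
    · exact ev_symTr M T T _ Ss _ _ _ w (fun _ => Iff.rfl) (fun _ _ => Iff.rfl) θ
    · exact ev_symTr M T T _ Ss _ _ _ w (fun _ => Iff.rfl) (fun _ _ => Iff.rfl) η
  simp only [key]
  rw [h, h']
  constructor
  · rintro ⟨⟨S1, h1⟩, ⟨S2, h2⟩⟩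
    exact ⟨fun i => match i with | .inl i => S1 i | .inr j => S2 j, fun w => ⟨h1 _, h2 _⟩⟩
  · rintro ⟨Ss, hs⟩
    obtain ⟨a⟩ := (inferInstance : Nonempty A)
    exact ⟨⟨fun i => Ss (.inl i), fun w => (hs (Sum.elim w fun _ => a)).1⟩,
      ⟨fun i => Ss (.inr i), fun w => (hs (Sum.elim (fun _ => a) w)).2⟩⟩

theorem SNPDef.or {σ : Type} {ar : σ → ℕ} {k l : ℕ} (f : Fin k → Fin l)
    {P Q : ∀ A : Type, DepStr σ ar A → Set (Fin l → A) → Prop}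
    (hP : SNPDef ar l P) (hQ : SNPDef ar l Q) :
    SNPDef ar k (fun A M T => ∃ T₁ T₂ : Set (Fin l → A),
      (∀ s : Fin l → A, (fun i => s (f i)) ∈ T ↔ s ∈ T₁ ∨ s ∈ T₂) ∧ P A M T₁ ∧ Q A M T₂) := by
  obtain ⟨I, _, arI, W, _, θ, h⟩ := hP
  obtain ⟨J, _, arJ, U, _, η, h'⟩ := hQ
  let K := (Unit ⊕ Unit) ⊕ (I ⊕ J)
  let arK : K → ℕ := Sum.elim (fun _ => l) (Sum.elim arI arJ)
  let V := Fin l ⊕ (W ⊕ U)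
  let a0 : QFm ((σ ⊕ Unit) ⊕ K) (gAr ar k arK) V := Ratom (fun i => Sum.inl (f i))
  let a1 : QFm ((σ ⊕ Unit) ⊕ K) (gAr ar k arK) V :=
    Satom (Sum.inl (Sum.inl ()) : K) (fun i : Fin l => (Sum.inl i : V))
  let a2 : QFm ((σ ⊕ Unit) ⊕ K) (gAr ar k arK) V :=
    Satom (Sum.inl (Sum.inr ()) : K) (fun i : Fin l => (Sum.inl i : V))
  let c1 : QFm ((σ ⊕ Unit) ⊕ K) (gAr ar k arK) V :=
    .and (.or (.not a0) (.or a1 a2)) (.or a0 (.not (.or a1 a2)))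
  let c2 : QFm ((σ ⊕ Unit) ⊕ K) (gAr ar k arK) V :=
    QFm.tr (symTr (fun ts => Satom (Sum.inl (Sum.inl ()) : K) ts)
      (fun i ts => Satom (Sum.inr (Sum.inl i) : K) ts)) (fun x => Sum.inr (Sum.inl x)) θ
  let c3 : QFm ((σ ⊕ Unit) ⊕ K) (gAr ar k arK) V :=
    QFm.tr (symTr (fun ts => Satom (Sum.inl (Sum.inr ()) : K) ts)
      (fun i ts => Satom (Sum.inr (Sum.inr i) : K) ts)) (fun x => Sum.inr (Sum.inr x)) η
  refine ⟨K, inferInstance, arK, V, inferInstance, .and c1 (.and c2 c3), ?_⟩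
  intro A _ M T
  have key : ∀ (Ss : ∀ i : K, (Fin (arK i) → A) → Prop) (w : V → A),
      QFm.ev (gExp M T Ss) w (.and c1 (.and c2 c3)) ↔
      ((fun i => w (Sum.inl (f i))) ∈ T ↔ Ss (Sum.inl (Sum.inl ())) (fun i => w (Sum.inl i)) ∨
        Ss (Sum.inl (Sum.inr ())) (fun i => w (Sum.inl i))) ∧
      QFm.ev (gExp M {v | Ss (Sum.inl (Sum.inl ())) v} (fun i => Ss (Sum.inr (Sum.inl i))))
        (fun v => w (Sum.inr (Sum.inl v))) θ ∧
      QFm.ev (gExp M {v | Ss (Sum.inl (Sum.inr ())) v} (fun i => Ss (Sum.inr (Sum.inr i))))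
        (fun v => w (Sum.inr (Sum.inr v))) η := by
    intro Ss w
    refine and_congr ?_ (and_congr ?_ ?_)
    · simp only [c1, QFm.ev, a0, a1, a2, ev_Ratom, ev_Satom]
      tauto
    · exact ev_symTr M _ T _ Ss _ _ _ w (fun _ => Iff.rfl) (fun _ _ => Iff.rfl) θ
    · exact ev_symTr M _ T _ Ss _ _ _ w (fun _ => Iff.rfl) (fun _ _ => Iff.rfl) η
  simp only [key]
  constructor
  · rintro ⟨T₁, T₂, hT, h1, h2⟩
    obtain ⟨S1, h1⟩ := (h A M T₁).1 h1
    obtain ⟨S2, h2⟩ := (h' A M T₂).1 h2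
    exact ⟨fun i => match i with
      | .inl (.inl _) => fun v => v ∈ T₁
      | .inl (.inr _) => fun v => v ∈ T₂
      | .inr (.inl i) => S1 i
      | .inr (.inr j) => S2 j, fun w => ⟨hT (fun i => w (.inl i)), h1 _, h2 _⟩⟩
  · rintro ⟨Ss, hs⟩
    obtain ⟨a⟩ := (inferInstance : Nonempty A)
    refine ⟨{v | Ss (Sum.inl (Sum.inl ())) v}, {v | Ss (Sum.inl (Sum.inr ())) v}, ?_,
      (h _ _ _).2 ⟨fun i => Ss (Sum.inr (Sum.inl i)), ?_⟩,
      (h' _ _ _).2 ⟨fun i => Ss (Sum.inr (Sum.inr i)), ?_⟩⟩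
    · exact fun s => (hs (Sum.elim s fun _ => a)).1
    · exact fun s => (hs (Sum.elim (fun _ => a) (Sum.elim s fun _ => a))).2.1
    · exact fun s => (hs (Sum.elim (fun _ => a) (Sum.elim (fun _ => a) s))).2.2

theorem SNPDef.congr {σ : Type} {ar : σ → ℕ} {k : ℕ}
    {P Q : ∀ A : Type, DepStr σ ar A → Set (Fin k → A) → Prop}
    (hP : SNPDef ar k P) (h : ∀ A M T, Q A M T ↔ P A M T) : SNPDef ar k Q := by
  have : Q = P := by
    funext A M T
    exact propext (h A M T)
  rwa [this]

theorem snp_main {σ : Type} {ar : σ → ℕ} {V : Type} (φ : DepFormula σ ar V) :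
    ∀ [Finite V], DepFormula.noEx V φ → ∀ (k : ℕ) (f : Fin k → V),
      SNPDef ar k (fun A M T => DepSat M V φ {s | (fun i => s (f i)) ∈ T}) := by
  induction φ with
  | @rel V r ts =>
    intro _ _ k f
    refine SNPDef.of_qf (W := V) _ (.or (.not (Ratom f)) (.rel (.inl (.inl r)) ts)) ?_
    intro A M T Ss
    exact forall_congr' fun s => imp_iff_not_or
  | @nrel V r ts =>
    intro _ _ k f
    refine SNPDef.of_qf (W := V) _ (.or (.not (Ratom f)) (.not (.rel (.inl (.inl r)) ts))) ?_
    intro A M T Ss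
    exact forall_congr' fun s => imp_iff_not_or
  | @eq V x y =>
    intro _ _ k f
    refine SNPDef.of_qf (W := V) _ (.or (.not (Ratom f)) (.eq x y)) ?_
    intro A M T Ss
    exact forall_congr' fun s => imp_iff_not_or
  | @neq V x y =>
    intro _ _ k f
    refine SNPDef.of_qf (W := V) _ (.or (.not (Ratom f)) (.not (.eq x y))) ?_
    intro A M T Ss
    exact forall_congr' fun s => imp_iff_not_or
  | @dep V m ys z =>
    intro _ _ k f
    refine SNPDef.of_qf (W := V ⊕ V) _ (.or (.not (Ratom fun i => .inl (f i)))
      (.or (.not (Ratom fun i => .inr (f i))) (QFm.impEqs (.eq (.inl z) (.inr z))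
        (List.ofFn fun i => (.inl (ys i), .inr (ys i)))))) ?_
    intro A M T Ss
    simp only [DepSat, QFm.ev, QFm.ev_impEqs, ev_Ratom, Set.mem_ofPred_eq, List.forall_mem_ofFn_iff]
    constructor
    · intro h w
      have := h (fun v => w (.inl v))
      have := fun h1 => this h1 (fun v => w (.inr v))
      tauto
    · intro h s₁ h1 s₂ h2 h3
      have := h (Sum.elim s₁ s₂)
      simp only [Sum.elim_inl, Sum.elim_inr] at this
      tauto
  | and φ ψ ih1 ih2 =>
    intro _ hn k f
    exact (SNPDef.and (ih1 hn.1 k f) (ih2 hn.2 k f)).congr fun A M T => Iff.rfl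
  | @or V φ ψ ih1 ih2 =>
    intro _ hn k f
    obtain ⟨l, ⟨e⟩⟩ := Finite.exists_equiv_fin V
    refine (SNPDef.or (fun i => e (f i)) (ih1 hn.1 l e.symm) (ih2 hn.2 l e.symm)).congr
      fun A M T => ?_
    have back : ∀ T' : Set (V → A), {s : V → A | (fun i => s (e.symm i)) ∈
        {t : Fin l → A | (fun v => t (e v)) ∈ T'}} = T' := by
      intro T'
      ext s
      simp
    simp only [DepSat]
    constructor
    · rintro ⟨T₁, T₂, hT, h1, h2⟩
      refine ⟨{t | (fun v => t (e v)) ∈ T₁}, {t | (fun v => t (e v)) ∈ T₂}, ?_, ?_, ?_⟩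
      · intro s
        have := Set.ext_iff.1 hT (fun v => s (e v))
        exact this
      · rwa [back]
      · rwa [back]
    · rintro ⟨T₁, T₂, hT, h1, h2⟩
      refine ⟨_, _, ?_, h1, h2⟩
      ext s
      have := hT (fun i => s (e.symm i))
      simpa using this
  | all φ ih =>
    intro _ hn k f
    exact (ih hn k (fun i => some (f i))).congr fun A M T => Iff.rfl
  | ex φ ih =>
    intro _ hn
    exact hn.elim

theorem sat_allIter {σ : Type} {ar : σ → ℕ} {A : Type} (M : DepStr σ ar A) (l : ℕ) {V : Type}
    (θ : FOForm σ ar (OptIter l V)) (s : V → A) :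
    FOSat M V (FOForm.allIter l θ) s ↔
      ∀ w : OptIter l V → A, (∀ v, w (optEmbed l v) = s v) → FOSat M _ θ w := by
  induction l with
  | zero =>
    constructor
    · intro h w hw
      have : w = s := funext hw
      rw [this]; exact h
    · intro h
      exact h s fun _ => rfl
  | succ l ih =>
    refine (ih (.all θ)).trans ?_
    constructor
    · intro h w hw
      have := h (fun v => w (some v)) hw (w none)
      have hw' : w = fun o => Option.elim o (w none) (fun v => w (some v)) := by
        funext o
        cases o <;> rfl
      rw [hw']
      exact this
    · intro h w hw a
      exact h (fun o => Option.elim o a w) hw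

def optEquiv : (l : ℕ) → Fin l ≃ OptIter l Empty
  | 0 => (Equiv.equivOfIsEmpty (Fin 0) Empty)
  | l+1 => (finSuccEquiv l).trans (Equiv.optionCongr (optEquiv l))

theorem stmt1 {σ : Type} {ar : σ → ℕ} {n : ℕ}
    (φ : DepFormula σ ar (Fin n)) (hφ : DepFormula.noEx (Fin n) φ) :
    ∃ (m' : ℕ) (arS : Fin m' → ℕ) (m : ℕ)
      (θ : FOForm ((σ ⊕ Unit) ⊕ Fin m') (exAr2 ar n arS) (OptIter m Empty)),
      FOForm.isQF (OptIter m Empty) θ ∧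
      ∀ (A : Type) [Nonempty A] (M : DepStr σ ar A) (T : Set (Fin n → A)),
        DepSat M (Fin n) φ T ↔
          ∃ Ss : ∀ i : Fin m', (Fin (arS i) → A) → Prop,
            FOTrue (expandRS M T Ss) (FOForm.allIter m θ) := by
  obtain ⟨I, _, arI, W, _, θ, h⟩ := snp_main φ hφ n (fun i => i)
  obtain ⟨m', ⟨e⟩⟩ := Finite.exists_equiv_fin I
  obtain ⟨m, ⟨d⟩⟩ := Finite.exists_equiv_fin W
  let g : W ≃ OptIter m Empty := d.trans (optEquiv m)
  let arS : Fin m' → ℕ := fun j => arI (e.symm j)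
  have hc : ∀ i, arS (e i) = arI i := fun i => congrArg arI (e.symm_apply_apply i)
  let η : QFm ((σ ⊕ Unit) ⊕ Fin m') (gAr ar n arS) (OptIter m Empty) :=
    QFm.tr (symTr Ratom (fun i ts => Satom (e i) (fun j => ts (Fin.cast (hc i) j)))) g θ
  refine ⟨m', arS, m, η.toFO, η.toFO_qf, ?_⟩
  intro A _ M T
  have key : ∀ Ss : ∀ i : Fin m', (Fin (arS i) → A) → Prop,
      FOTrue (expandRS M T Ss) (FOForm.allIter m η.toFO) ↔
      ∀ w : W → A, QFm.ev (gExp M T (fun i v => Ss (e i) (fun j => v (Fin.cast (hc i) j)))) w θ := by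
    intro Ss
    have h1 : ∀ w : OptIter m Empty → A, FOSat (gExp M T Ss) _ η.toFO w ↔
        QFm.ev (gExp M T (fun i v => Ss (e i) (fun j => v (Fin.cast (hc i) j))))
          (fun v => w (g v)) θ := by
      intro w
      refine (QFm.sat_toFO (gExp M T Ss) w η).trans ?_
      exact ev_symTr M T T (fun i v => Ss (e i) (fun j => v (Fin.cast (hc i) j))) Ss
        Ratom (fun i ts => Satom (e i) (fun j => ts (Fin.cast (hc i) j))) g w (fun _ => Iff.rfl) (fun _ _ => Iff.rfl) θ
    have hexp : (expandRS M T Ss : DepStr _ (gAr ar n arS) A) = gExp M T Ss := by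
      refine congrArg DepStr.mk (funext ?_)
      rintro ((r | u) | i) <;> rfl
    change FOSat (ar := gAr ar n arS) (expandRS M T Ss) Empty (FOForm.allIter m η.toFO) _ ↔ _
    rw [hexp]
    refine (sat_allIter _ _ _ _).trans ?_
    constructor
    · intro H w
      have := (h1 (fun v => w (g.symm v))).1 (H _ fun v => v.elim)
      simpa using this
    · intro H w _
      exact (h1 w).2 (H _)
  simp only [key]
  refine (h A M T).trans ?_
  constructor
  · rintro ⟨Ss, hs⟩
    refine ⟨fun j => Ss (e.symm j), ?_⟩
    have aux : ∀ (i i' : I) (hi : i' = i) (hc : arI i' = arI i) (v : Fin (arI i) → A),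
        Ss i' (fun j => v (Fin.cast hc j)) = Ss i v := by
      intro i i' hi hc v
      subst hi
      rfl
    have : (fun i v => Ss (e.symm (e i)) (fun j => v (Fin.cast (hc i) j))) = Ss := by
      funext i v
      exact aux i _ (e.symm_apply_apply i) _ v
    intro w
    rw [this]
    exact hs w
  · rintro ⟨Ss, hs⟩
    exact ⟨_, hs⟩
end

section
/- If φ(x₁,…,xₙ) is a coherent DQF(τ)-formula, then φ is rewritable to a universal first-order sentence: there is a universal first-order sentence φ* over τ ∪ {R}, with R a fresh n-ary relation symbol, such that for every τ-structure A and every team T with domain {x₁,…,xₙ}: A ⊨_T φ if and only if (A, Rel(T)) ⊨ φ*, where Rel(T) = {(s(x₁),…,s(xₙ)) : s ∈ T}. -/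
/-- A uniformly quantifier-free definable property of assignments in `(M, Rel T)`. -/
def QFDef {σ : Type} (ar : σ → ℕ) (n : ℕ) (W : Type)
    (P : ∀ A : Type, DepStr σ ar A → Set (Fin n → A) → (W → A) → Prop) : Prop :=
  ∃ θ : FOForm (σ ⊕ Unit) (exAr ar n) W, FOForm.isQF W θ ∧
    ∀ (A : Type) (M : DepStr σ ar A) (T : Set (Fin n → A)) (s : W → A),
      FOSat (expandR M T) W θ s ↔ P A M T s

namespace QFDef

variable {σ : Type} {ar : σ → ℕ} {n : ℕ} {W : Type}
  {P Q : ∀ A : Type, DepStr σ ar A → Set (Fin n → A) → (W → A) → Prop}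

theorem congr (hP : QFDef ar n W P) (h : ∀ A M T s, P A M T s ↔ Q A M T s) :
    QFDef ar n W Q := by
  obtain ⟨θ, h1, h2⟩ := hP
  exact ⟨θ, h1, fun A M T s => (h2 A M T s).trans (h A M T s)⟩

theorem and (hP : QFDef ar n W P) (hQ : QFDef ar n W Q) :
    QFDef ar n W (fun A M T s => P A M T s ∧ Q A M T s) := by
  obtain ⟨θ, h1, h2⟩ := hP
  obtain ⟨η, g1, g2⟩ := hQ
  refine ⟨.and θ η, ⟨h1, g1⟩, fun A M T s => ?_⟩
  rw [FOSat, h2, g2]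

theorem not (hP : QFDef ar n W P) :
    QFDef ar n W (fun A M T s => ¬ P A M T s) := by
  obtain ⟨θ, h1, h2⟩ := hP
  refine ⟨.not θ, h1, fun A M T s => ?_⟩
  rw [FOSat, h2]

theorem imp (hP : QFDef ar n W P) (hQ : QFDef ar n W Q) :
    QFDef ar n W (fun A M T s => P A M T s → Q A M T s) :=
  (hP.and hQ.not).not.congr fun A M T s => by tauto

theorem team (t : Fin n → W) :
    QFDef ar n W (fun _ _ T s => (fun i => s (t i)) ∈ T) :=
  ⟨.rel (Sum.inr ()) t, trivial, fun A M T s => Iff.rfl⟩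

theorem rel (r : σ) (t : Fin (ar r) → W) :
    QFDef ar n W (fun _ M _ s => M.rel r (fun i => s (t i))) :=
  ⟨.rel (Sum.inl r) t, trivial, fun A M T s => Iff.rfl⟩

theorem eq (x y : W) : QFDef ar n W (fun _ _ _ s => s x = s y) :=
  ⟨.eq x y, trivial, fun A M T s => Iff.rfl⟩

theorem const (t : Fin n → W) (p : Prop) : QFDef ar n W (fun _ _ _ _ => p) := by
  by_cases hp : p
  · exact ((team (ar := ar) t).imp (team t)).congr fun A M T s => by tauto
  · exact ((team (ar := ar) t).and (team t).not).congr fun A M T s => by tauto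

theorem all (t : Fin n → W) {ι : Type} [Finite ι]
    {R : ι → ∀ A : Type, DepStr σ ar A → Set (Fin n → A) → (W → A) → Prop}
    (h : ∀ i, QFDef ar n W (R i)) :
    QFDef ar n W (fun A M T s => ∀ i, R i A M T s) := by
  classical
  have := Fintype.ofFinite ι
  have key : ∀ F : Finset ι, QFDef ar n W (fun A M T s => ∀ i ∈ F, R i A M T s) := by
    intro F
    induction F using Finset.induction_on with
    | empty => exact (const t True).congr fun A M T s => by simp
    | insert a F _ ih => exact ((h a).and ih).congr fun A M T s => by simp
  exact (key Finset.univ).congr fun A M T s => by simp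

theorem ex (t : Fin n → W) {ι : Type} [Finite ι]
    {R : ι → ∀ A : Type, DepStr σ ar A → Set (Fin n → A) → (W → A) → Prop}
    (h : ∀ i, QFDef ar n W (R i)) :
    QFDef ar n W (fun A M T s => ∃ i, R i A M T s) :=
  (all t fun i => (h i).not).not.congr fun A M T s => by simp

theorem depSat (t : Fin n → W) {k : ℕ} {V : Type} (φ : DepFormula σ ar V)
    (hqf : DepFormula.isQF V φ) (x : Fin k → V → W) :
    ∀ I : Set (Fin k), QFDef ar n W
      (fun _ M _ s => DepSat M V φ ((fun i v => s (x i v)) '' I)) := by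
  induction φ with
  | rel r ts =>
    intro I
    refine (all t fun i => (const t (i ∈ I)).imp (rel r fun j => x i (ts j))).congr ?_
    intro A M T s
    simp [DepSat]
  | nrel r ts =>
    intro I
    refine (all t fun i => (const t (i ∈ I)).imp (rel r fun j => x i (ts j)).not).congr ?_
    intro A M T s
    simp [DepSat]
  | eq y z =>
    intro I
    refine (all t fun i => (const t (i ∈ I)).imp (eq (x i y) (x i z))).congr ?_
    intro A M T s
    simp [DepSat]
  | neq y z =>
    intro I
    refine (all t fun i => (const t (i ∈ I)).imp (eq (x i y) (x i z)).not).congr ?_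
    intro A M T s
    simp [DepSat]
  | dep m ys z =>
    intro I
    refine (all t fun i => (const t (i ∈ I)).imp (all t fun j => (const t (j ∈ I)).imp
      ((all t fun l => eq (x i (ys l)) (x j (ys l))).imp (eq (x i z) (x j z))))).congr ?_
    intro A M T s
    simp [DepSat]
  | and φ ψ ih1 ih2 =>
    intro I
    exact ((ih1 hqf.1 x I).and (ih2 hqf.2 x I)).congr fun A M T s => by rw [DepSat]
  | or φ ψ ih1 ih2 =>
    intro I
    refine (ex t fun p : Set (Fin k) × Set (Fin k) => (const t (I = p.1 ∪ p.2)).and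
      ((ih1 hqf.1 x p.1).and (ih2 hqf.2 x p.2))).congr ?_
    intro A M T s
    rw [DepSat]
    constructor
    · rintro ⟨⟨I1, I2⟩, h, h1, h2⟩
      exact ⟨_, _, by rw [h, Set.image_union], h1, h2⟩
    · rintro ⟨T1, T2, h, h1, h2⟩
      have aux : ∀ T' : Set (_ → A), T' ⊆ T1 ∪ T2 →
          (fun i v => s (x i v)) '' (I ∩ (fun i v => s (x i v)) ⁻¹' T') = T' := by
        intro T' hT
        rw [Set.image_inter_preimage, h]
        exact Set.inter_eq_right.2 hT
      refine ⟨(I ∩ (fun i v => s (x i v)) ⁻¹' T1, I ∩ (fun i v => s (x i v)) ⁻¹' T2), ?_, ?_, ?_⟩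
      · rw [← Set.inter_union_distrib_left, ← Set.preimage_union, ← h]
        exact (Set.inter_eq_left.2 (Set.subset_preimage_image _ _)).symm
      · rw [aux _ Set.subset_union_left]; exact h1
      · rw [aux _ Set.subset_union_right]; exact h2
  | all φ ih => exact hqf.elim
  | ex φ ih => exact hqf.elim

end QFDef

theorem depSat_empty {σ : Type} {ar : σ → ℕ} {A : Type} (M : DepStr σ ar A) {V : Type}
    (φ : DepFormula σ ar V) (hqf : DepFormula.isQF V φ) : DepSat M V φ ∅ := by
  induction φ with
  | and φ ψ ih1 ih2 => exact ⟨ih1 hqf.1, ih2 hqf.2⟩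
  | or φ ψ ih1 ih2 => exact ⟨∅, ∅, by simp, ih1 hqf.1, ih2 hqf.2⟩
  | all φ ih => exact hqf.elim
  | ex φ ih => exact hqf.elim
  | _ => simp [DepSat]

theorem allIter_universal {σ : Type} {ar : σ → ℕ} (l : ℕ) {V : Type}
    (φ : FOForm σ ar (OptIter l V)) (h : φ.IsUniversal) : (FOForm.allIter l φ).IsUniversal := by
  induction l with
  | zero => exact h
  | succ l ih => exact ih _ (.all _ h)

theorem allIter_sat {σ : Type} {ar : σ → ℕ} {A : Type} (M : DepStr σ ar A) (l : ℕ)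
    (φ : FOForm σ ar (OptIter l Empty)) (e : Empty → A) :
    FOSat M Empty (FOForm.allIter l φ) e ↔ ∀ s, FOSat M _ φ s := by
  induction l with
  | zero =>
    constructor
    · intro h s
      have : s = e := funext fun a => Empty.elim a
      rw [this]; exact h
    · intro h; exact h e
  | succ l ih =>
    refine (ih (.all φ)).trans ?_
    constructor
    · intro h s
      have := h (fun v => s (some v)) (s none)
      have hs : (fun o : Option (OptIter l Empty) =>
          Option.elim o (s none) (fun v => s (some v))) = s := by
        funext o
        cases o <;> rfl
      rw [hs] at this
      exact this
    · intro h s a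
      exact h _

theorem optIter_equiv (l : ℕ) : Nonempty (Fin l ≃ OptIter l Empty) := by
  induction l with
  | zero => exact ⟨finZeroEquiv⟩
  | succ l ih =>
    obtain ⟨e⟩ := ih
    exact ⟨(finSuccEquiv l).trans e.optionCongr⟩

/-- A coherent quantifier-free dependence formula `φ(x₁,…,xₙ)`
is rewritable to a universal first-order sentence over `τ ∪ {R}`. -/
theorem stmt2 {σ : Type} {ar : σ → ℕ} {n : ℕ}
    (φ : DepFormula σ ar (Fin n)) (hqf : DepFormula.isQF (Fin n) φ)
    (hcoh : Coherent φ) :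
    UnivRewritable φ := by
  obtain ⟨k, hk, hc⟩ := hcoh
  obtain ⟨e⟩ := optIter_equiv (k * n)
  let x : Fin k → Fin n → OptIter (k * n) Empty := fun i v => e (finProdFinEquiv (i, v))
  let t := x ⟨0, hk⟩
  obtain ⟨θ, h1, h2⟩ := (QFDef.all t fun i => QFDef.team (ar := ar) (x i)).imp
    (QFDef.depSat t φ hqf x Set.univ)
  refine ⟨FOForm.allIter (k * n) θ, allIter_universal _ _ (.of_qf _ h1), ?_⟩
  intro A _ M T
  rw [FOTrue, allIter_sat, hc A M T]
  simp only [h2]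
  constructor
  · intro h s hs
    apply h
    · rintro _ ⟨i, -, rfl⟩
      exact hs i
    · exact Set.toFinite _
    · refine (Set.ncard_image_le (Set.toFinite _)).trans ?_
      simp [Set.ncard_univ]
  · intro h S hST hfin hcard
    rcases S.eq_empty_or_nonempty with rfl | hne
    · exact depSat_empty M φ hqf
    have hf : ∃ f : Fin k → (Fin n → A), Set.range f = S := by
      have := hfin.fintype
      have := hne.to_subtype
      have hc' : Fintype.card S ≤ Fintype.card (Fin k) := by
        rw [Fintype.card_fin, ← Nat.card_eq_fintype_card]; exact hcard
      obtain ⟨g⟩ := Function.Embedding.nonempty_of_card_le hc'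
      refine ⟨fun i => (Function.invFun g i : S), ?_⟩
      have hs := Function.invFun_surjective g.injective
      change Set.range (Subtype.val ∘ Function.invFun g) = S
      rw [hs.range_comp, Subtype.range_coe]
    obtain ⟨f, rfl⟩ := hf
    have hx : (fun i v => (fun w => Function.uncurry f (finProdFinEquiv.symm (e.symm w)))
        (x i v)) = f := by
      funext i v
      simp [x]
    have := h (fun w => Function.uncurry f (finProdFinEquiv.symm (e.symm w))) ?_
    · rw [hx, Set.image_univ] at this
      exact this
    · intro i
      have := congrFun hx i
      rw [this]
      exact hST ⟨i, rfl⟩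
end

section
/- Let τ be a relational vocabulary and φ(x₁,…,xₙ) a ∀D(τ)-formula. If φ is first-order rewritable, then φ is coherent. Moreover, if the rewriting sentence is equivalent to a universal first-order sentence with m universal quantifiers, then φ is mⁿ-coherent. -/
theorem DepSat.mono {σ : Type} {ar : σ → ℕ} {A : Type} (M : DepStr σ ar A) {V : Type}
    (φ : DepFormula σ ar V) : ∀ {S T : Set (V → A)}, S ⊆ T → DepSat M V φ T → DepSat M V φ S := by
  induction φ with
  | rel r ts => intro S T h hT s hs; exact hT s (h hs)
  | nrel r ts => intro S T h hT s hs; exact hT s (h hs)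
  | eq x y => intro S T h hT s hs; exact hT s (h hs)
  | neq x y => intro S T h hT s hs; exact hT s (h hs)
  | dep m ys z => intro S T h hT s hs t ht; exact hT s (h hs) t (h ht)
  | and φ ψ ih1 ih2 => intro S T h hT; exact ⟨ih1 h hT.1, ih2 h hT.2⟩
  | or φ ψ ih1 ih2 =>
    intro S T h hT
    obtain ⟨T₁, T₂, rfl, h1, h2⟩ := hT
    refine ⟨S ∩ T₁, S ∩ T₂, ?_, ih1 Set.inter_subset_right h1, ih2 Set.inter_subset_right h2⟩
    rw [← Set.inter_union_distrib_left, Set.inter_eq_left.2 h]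
  | all φ ih => intro S T h hT; exact ih (fun s hs => h hs) hT
  | ex φ ih =>
    intro S T h hT
    obtain ⟨f, hf⟩ := hT
    exact ⟨f, ih (by rintro s ⟨t, ht, e⟩; exact ⟨t, h ht, e⟩) hf⟩

/-- `∃`-free formulas have finite character. -/
theorem DepSat.of_finite {σ : Type} {ar : σ → ℕ} {A : Type} (M : DepStr σ ar A) {V : Type}
    (φ : DepFormula σ ar V) : DepFormula.noEx V φ → ∀ {T : Set (V → A)},
      (∀ S ⊆ T, S.Finite → DepSat M V φ S) → DepSat M V φ T := by
  induction φ with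
  | rel r ts =>
    intro _ T h s hs
    exact h {s} (by simpa using hs) (Set.finite_singleton s) s rfl
  | nrel r ts =>
    intro _ T h s hs
    exact h {s} (by simpa using hs) (Set.finite_singleton s) s rfl
  | eq x y =>
    intro _ T h s hs
    exact h {s} (by simpa using hs) (Set.finite_singleton s) s rfl
  | neq x y =>
    intro _ T h s hs
    exact h {s} (by simpa using hs) (Set.finite_singleton s) s rfl
  | dep m ys z =>
    intro _ T h s hs t ht
    exact h {s, t} (Set.insert_subset hs (by simpa using ht)) (Set.toFinite _)
      s (by simp) t (by simp)
  | and φ ψ ih1 ih2 =>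
    intro hn T h
    exact ⟨ih1 hn.1 fun S hS hf => (h S hS hf).1, ih2 hn.2 fun S hS hf => (h S hS hf).2⟩
  | or φ ψ ih1 ih2 =>
    rename_i V
    intro hn T h
    have h' : ∀ F : Finset (V → A), ∃ P Q : Set (V → A), (F : Set (V → A)) ∩ T = P ∪ Q ∧
        DepSat M V φ P ∧ DepSat M V ψ Q := fun F =>
      h _ Set.inter_subset_right (F.finite_toSet.inter_of_left T)
    choose P Q hPQ hP hQ using h'
    classical
    let U : Ultrafilter (Finset (V → A)) := Ultrafilter.of Filter.atTop
    have hU : (U : Filter (Finset (V → A))) ≤ Filter.atTop := Ultrafilter.of_le _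
    refine ⟨{s | s ∈ T ∧ ∀ᶠ F in (U : Filter _), s ∈ P F},
      {s | s ∈ T ∧ ∀ᶠ F in (U : Filter _), s ∈ Q F}, ?_, ih1 hn.1 ?_, ih2 hn.2 ?_⟩
    · ext s
      constructor
      · intro hs
        have h1 : ∀ᶠ F in (U : Filter (Finset (V → A))), s ∈ P F ∨ s ∈ Q F := by
          have h2 : ∀ᶠ F in (U : Filter (Finset (V → A))), {s} ≤ F :=
            Filter.Eventually.filter_mono hU (Filter.eventually_ge_atTop ({s} : Finset (V → A)))
          filter_upwards [h2] with F hF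
          have : s ∈ (F : Set (V → A)) ∩ T := ⟨by simpa using hF, hs⟩
          rw [hPQ F] at this
          exact this
        rcases Ultrafilter.eventually_or.1 h1 with h1 | h1
        · exact Or.inl ⟨hs, h1⟩
        · exact Or.inr ⟨hs, h1⟩
      · rintro (hs | hs)
        · exact hs.1
        · exact hs.1
    · intro S hS hf
      have : ∀ᶠ F in (U : Filter (Finset (V → A))), ∀ s ∈ S, s ∈ P F :=
        (Filter.eventually_all_finite hf).2 fun s hs => (hS hs).2
      obtain ⟨F, hF⟩ := this.exists
      exact DepSat.mono M φ hF (hP F)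
    · intro S hS hf
      have : ∀ᶠ F in (U : Filter (Finset (V → A))), ∀ s ∈ S, s ∈ Q F :=
        (Filter.eventually_all_finite hf).2 fun s hs => (hS hs).2
      obtain ⟨F, hF⟩ := this.exists
      exact DepSat.mono M ψ hF (hQ F)
  | all φ ih =>
    rename_i V
    intro hn T h
    refine ih hn fun S hS hf => ?_
    have := h (Set.image (fun s v => s (some v)) S) (by rintro _ ⟨s, hs, rfl⟩; exact hS hs) (hf.image _)
    exact DepSat.mono M φ (by intro s hs; exact ⟨s, hs, rfl⟩) this
  | ex φ ih => intro hn; exact hn.elim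

/-- The universe of an ultraproduct. -/
def UProd (U : Ultrafilter ℕ) (A : ℕ → Type) : Type :=
  Quotient ((U : Filter ℕ).productSetoid A)

/-- The class of a sequence. -/
def UProd.mk (U : Ultrafilter ℕ) (A : ℕ → Type) (g : ∀ k, A k) : UProd U A :=
  Quotient.mk ((U : Filter ℕ).productSetoid A) g

/-- A chosen representative. -/
noncomputable def UProd.out {U : Ultrafilter ℕ} {A : ℕ → Type} (a : UProd U A) : ∀ k, A k :=
  @Quotient.out _ ((U : Filter ℕ).productSetoid A) a

theorem UProd.out_mk (U : Ultrafilter ℕ) (A : ℕ → Type) (g : ∀ k, A k) :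
    ∀ᶠ k in (U : Filter ℕ), (UProd.mk U A g).out k = g k :=
  Quotient.exact (Quotient.out_eq (Quotient.mk ((U : Filter ℕ).productSetoid A) g))

theorem UProd.eq_iff (U : Ultrafilter ℕ) (A : ℕ → Type) (a b : UProd U A) :
    a = b ↔ ∀ᶠ k in (U : Filter ℕ), UProd.out a k = UProd.out b k :=
  ⟨fun h => by subst h; simp, fun h => (@Quotient.out_equiv_out _ ((U : Filter ℕ).productSetoid A) a b).1 h⟩

/-- The ultraproduct structure. -/
def uprodStr {σ : Type} {ar : σ → ℕ} (U : Ultrafilter ℕ) (A : ℕ → Type)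
    (M : ∀ k, DepStr σ ar (A k)) : DepStr σ ar (UProd U A) :=
  ⟨fun r v => ∀ᶠ k in (U : Filter ℕ), (M k).rel r fun i => UProd.out (v i) k⟩

theorem elim_out_eq (U : Ultrafilter ℕ) (A : ℕ → Type) {V : Type} (a : UProd U A)
    (s : V → UProd U A) (k : ℕ) :
    (fun o : Option V => UProd.out (Option.elim o a s) k) =
      fun o => Option.elim o (UProd.out a k) (fun v => UProd.out (s v) k) := by
  funext o; cases o <;> rfl

theorem los {σ : Type} {ar : σ → ℕ} (U : Ultrafilter ℕ) (A : ℕ → Type) [∀ k, Nonempty (A k)]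
    (M : ∀ k, DepStr σ ar (A k)) {V : Type} (φ : FOForm σ ar V) : ∀ s : V → UProd U A,
    FOSat (uprodStr U A M) V φ s ↔
      ∀ᶠ k in (U : Filter ℕ), FOSat (M k) V φ (fun v => UProd.out (s v) k) := by
  induction φ with
  | rel r ts => intro s; exact Iff.rfl
  | eq x y => intro s; exact UProd.eq_iff U A _ _
  | not φ ih =>
    intro s
    simp only [FOSat]
    rw [ih, Ultrafilter.eventually_not]
  | and φ ψ ih1 ih2 =>
    intro s
    simp only [FOSat]
    rw [ih1, ih2, Filter.eventually_and]
  | or φ ψ ih1 ih2 =>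
    intro s
    simp only [FOSat]
    rw [ih1, ih2, Ultrafilter.eventually_or]
  | all φ ih =>
    rename_i V
    intro s
    simp only [FOSat, ih, elim_out_eq]
    constructor
    · intro h
      by_contra hc
      rw [← Ultrafilter.eventually_not] at hc
      have : ∀ k, ∃ a : A k, (¬ ∀ a, FOSat (M k) (Option V) φ
          (fun o => Option.elim o a fun v => UProd.out (s v) k)) →
          ¬ FOSat (M k) (Option V) φ (fun o => Option.elim o a fun v => UProd.out (s v) k) := by
        intro k
        by_cases hk : ∀ a, FOSat (M k) (Option V) φ
          (fun o => Option.elim o a fun v => UProd.out (s v) k)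
        · exact ⟨Classical.arbitrary _, fun h => (h hk).elim⟩
        · obtain ⟨a, ha⟩ := not_forall.1 hk
          exact ⟨a, fun _ => ha⟩
      choose g hg using this
      obtain ⟨k, h1, h2, h3⟩ := ((h (UProd.mk U A g)).and (hc.and (UProd.out_mk U A g))).exists
      rw [h3] at h1
      exact hg k h2 h1
    · intro h a
      filter_upwards [h] with k hk using hk _
  | ex φ ih =>
    rename_i V
    intro s
    simp only [FOSat, ih, elim_out_eq]
    constructor
    · rintro ⟨a, ha⟩
      filter_upwards [ha] with k hk using ⟨_, hk⟩
    · intro h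
      have : ∀ k, ∃ a : A k, (∃ a, FOSat (M k) (Option V) φ
          (fun o => Option.elim o a fun v => UProd.out (s v) k)) →
          FOSat (M k) (Option V) φ (fun o => Option.elim o a fun v => UProd.out (s v) k) := by
        intro k
        by_cases hk : ∃ a, FOSat (M k) (Option V) φ
          (fun o => Option.elim o a fun v => UProd.out (s v) k)
        · obtain ⟨a, ha⟩ := hk
          exact ⟨a, fun _ => ha⟩
        · exact ⟨Classical.arbitrary _, fun h => (hk h).elim⟩
      choose g hg using this
      refine ⟨UProd.mk U A g, ?_⟩
      filter_upwards [h, UProd.out_mk U A g] with k h1 h3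
      rw [h3]
      exact hg k h1

/-- The limit team. -/
def uprodTeam (U : Ultrafilter ℕ) (A : ℕ → Type) {V : Type} (T : ∀ k, Set (V → A k)) :
    Set (V → UProd U A) :=
  {v | ∀ᶠ k in (U : Filter ℕ), (fun i => UProd.out (v i) k) ∈ T k}

theorem uprod_expandR {σ : Type} {ar : σ → ℕ} {n : ℕ} (U : Ultrafilter ℕ) (A : ℕ → Type)
    (M : ∀ k, DepStr σ ar (A k)) (T : ∀ k, Set (Fin n → A k)) :
    expandR (uprodStr U A M) (uprodTeam U A T) = uprodStr U A fun k => expandR (M k) (T k) := by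
  unfold expandR uprodStr
  congr 1
  funext r v
  rcases r with r | r <;> rfl

theorem rewrites_uprod {σ : Type} {ar : σ → ℕ} {n : ℕ} {φ : DepFormula σ ar (Fin n)}
    {ψ : FOForm (σ ⊕ Unit) (exAr ar n) Empty} (hψ : Rewrites ψ φ)
    (U : Ultrafilter ℕ) (A : ℕ → Type) [∀ k, Nonempty (A k)]
    (M : ∀ k, DepStr σ ar (A k)) (T : ∀ k, Set (Fin n → A k)) :
    DepSat (uprodStr U A M) (Fin n) φ (uprodTeam U A T) ↔
      ∀ᶠ k in (U : Filter ℕ), DepSat (M k) (Fin n) φ (T k) := by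
  have : Nonempty (UProd U A) := ⟨UProd.mk U A fun k => Classical.arbitrary (A k)⟩
  rw [hψ, uprod_expandR, FOTrue, los]
  refine Filter.eventually_congr (Filter.Eventually.of_forall fun k => ?_)
  rw [hψ, FOTrue]
  have : (fun v : Empty => UProd.out ((v.elim : UProd U A)) k) = fun e : Empty => e.elim := by
    funext e; exact e.elim
  rw [this]

theorem coherent_of_rewritable {σ : Type} {ar : σ → ℕ} {n : ℕ}
    (φ : DepFormula σ ar (Fin n)) (hφ : DepFormula.noEx (Fin n) φ) (h : FORewritable φ) :
    Coherent φ := by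
  obtain ⟨ψ, hψ⟩ := h
  by_contra hc
  have key : ∀ k : ℕ, ∃ (A : Type) (_ : Nonempty A) (M : DepStr σ ar A) (T : Set (Fin n → A)),
      (∀ S ⊆ T, S.Finite → S.ncard ≤ k → DepSat M (Fin n) φ S) ∧ ¬ DepSat M (Fin n) φ T := by
    intro k
    by_contra hk
    push Not at hk
    refine hc ⟨k + 1, by omega, ?_⟩
    intro A hA M T
    refine ⟨fun hT S hS _ _ => DepSat.mono M φ hS hT, fun hS => hk A hA M T ?_⟩
    intro S h1 h2 h3
    exact hS S h1 h2 (by omega)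
  choose A hA M T hS hT using key
  let U : Ultrafilter ℕ := Filter.hyperfilter ℕ
  have hU : (U : Filter ℕ) ≤ Filter.atTop := Nat.hyperfilter_le_atTop
  have h1 : ¬ DepSat (uprodStr U A M) (Fin n) φ (uprodTeam U A T) := by
    rw [rewrites_uprod hψ]
    intro h
    obtain ⟨k, hk⟩ := h.exists
    exact hT k hk
  refine h1 (DepSat.of_finite _ φ hφ fun S hST hf => ?_)
  let Ssub : ∀ k, Set (Fin n → A k) := fun k =>
    (Set.image (fun s : Fin n → UProd U A => fun i => UProd.out (s i) k) S) ∩ T k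
  have h2 : DepSat (uprodStr U A M) (Fin n) φ (uprodTeam U A Ssub) := by
    rw [rewrites_uprod hψ]
    have h3 : ∀ᶠ k in (U : Filter ℕ), S.ncard ≤ k := hU (Filter.eventually_ge_atTop _)
    filter_upwards [h3] with k hk
    refine hS k _ Set.inter_subset_right ((hf.image _).inter_of_left _) ?_
    exact (Set.ncard_le_ncard Set.inter_subset_left (hf.image _)).trans
      ((Set.ncard_image_le hf).trans hk)
  refine DepSat.mono _ φ (fun s hs => ?_) h2
  have h3 : ∀ᶠ k in (U : Filter ℕ), (fun i => UProd.out (s i) k) ∈ T k := hST hs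
  show ∀ᶠ k in (U : Filter ℕ), (fun i => UProd.out (s i) k) ∈ Ssub k
  filter_upwards [h3] with k hk
  exact ⟨⟨s, hs, rfl⟩, hk⟩

theorem FOSat_allIter {σ : Type} {ar : σ → ℕ} {A : Type} (M : DepStr σ ar A) {V : Type}
    (s : V → A) : ∀ (m : ℕ) (θ : FOForm σ ar (OptIter m V)),
    FOSat M V (FOForm.allIter m θ) s ↔ ∀ t : OptIter m V → A,
      (∀ v, t (optEmbed m v) = s v) → FOSat M (OptIter m V) θ t := by
  intro m
  induction m with
  | zero =>
    intro θ
    constructor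
    · intro h t ht
      have : t = s := funext ht
      rw [this]; exact h
    · intro h; exact h s fun _ => rfl
  | succ m ih =>
    intro θ
    refine (ih (.all θ)).trans ?_
    constructor
    · intro h t ht
      have := h (fun v => t (some v)) ht (t none)
      have e : (fun o : Option (OptIter m V) => Option.elim o (t none) fun v => t (some v)) = t := by
        funext o; cases o <;> rfl
      rw [e] at this
      exact this
    · intro h t ht a
      exact h (fun o => Option.elim o a t) ht

theorem FOSat_expandR_congr {σ : Type} {ar : σ → ℕ} {n : ℕ} {A : Type} (M : DepStr σ ar A)
    (S T : Set (Fin n → A)) {V : Type} (θ : FOForm (σ ⊕ Unit) (exAr ar n) V) :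
    FOForm.isQF V θ → ∀ t : V → A, (∀ v : Fin n → V, (fun i => t (v i)) ∈ S ↔ (fun i => t (v i)) ∈ T) →
    (FOSat (expandR M S) V θ t ↔ FOSat (expandR M T) V θ t) := by
  induction θ with
  | rel r ts =>
    intro _ t h
    rcases r with r | r
    · exact Iff.rfl
    · exact h ts
  | eq x y => intro _ t h; exact Iff.rfl
  | not φ ih => intro hq t h; exact not_congr (ih hq t h)
  | and φ ψ ih1 ih2 => intro hq t h; exact and_congr (ih1 hq.1 t h) (ih2 hq.2 t h)
  | or φ ψ ih1 ih2 => intro hq t h; exact or_congr (ih1 hq.1 t h) (ih2 hq.2 t h)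
  | all φ ih => intro hq; exact hq.elim
  | ex φ ih => intro hq; exact hq.elim

theorem OptIter_card : ∀ m : ℕ, Finite (OptIter m Empty) ∧ Nat.card (OptIter m Empty) = m
  | 0 => by
    change Finite Empty ∧ Nat.card Empty = 0
    exact ⟨inferInstance, by simp⟩
  | m + 1 => by
    obtain ⟨h1, h2⟩ := OptIter_card m
    change Finite (Option (OptIter m Empty)) ∧ Nat.card (Option (OptIter m Empty)) = m + 1
    exact ⟨inferInstance, by rw [Finite.card_option, h2]⟩

theorem kcoherent_of_univ {σ : Type} {ar : σ → ℕ} {n : ℕ}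
    (φ : DepFormula σ ar (Fin n)) (m : ℕ)
    (θ : FOForm (σ ⊕ Unit) (exAr ar n) (OptIter m Empty))
    (hθ : FOForm.isQF (OptIter m Empty) θ)
    (hr : Rewrites (FOForm.allIter m θ) φ) : KCoherent (m ^ n) φ := by
  intro A hA M T
  refine ⟨fun hT S hS _ _ => DepSat.mono M φ hS hT, fun hS => ?_⟩
  rw [hr, FOTrue, FOSat_allIter]
  intro t ht
  obtain ⟨hfin, hcard⟩ := OptIter_card m
  let R : Set (Fin n → A) :=
    Set.range fun v : Fin n → OptIter m Empty => fun i => t (v i)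
  have hR : R.Finite := Set.finite_range _
  have hRc : R.ncard ≤ m ^ n := by
    have h1 : R.ncard ≤ Nat.card (Fin n → OptIter m Empty) := by
      rw [← Nat.card_coe_set_eq]
      exact Finite.card_range_le _
    rw [Nat.card_fun, hcard, Nat.card_fin] at h1
    exact h1
  have h1 := hS (T ∩ R) Set.inter_subset_left (hR.inter_of_right T)
    ((Set.ncard_le_ncard Set.inter_subset_right hR).trans hRc)
  rw [hr, FOTrue, FOSat_allIter] at h1
  refine (FOSat_expandR_congr M (T ∩ R) T θ hθ t fun v => ?_).1 (h1 t ht)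
  exact ⟨fun h => h.1, fun h => ⟨h, v, rfl⟩⟩

/-- If an `∃`-free dependence formula `φ(x₁,…,xₙ)` is first-order
rewritable, then it is coherent; moreover if the rewriting sentence is (equivalent to)
a universal first-order sentence with `m` universal quantifiers, then `φ` is
`mⁿ`-coherent. -/
theorem stmt3 {σ : Type} {ar : σ → ℕ} {n : ℕ}
    (φ : DepFormula σ ar (Fin n)) (hφ : DepFormula.noEx (Fin n) φ) :
    (FORewritable φ → Coherent φ) ∧
    (∀ m : ℕ, 1 ≤ m →
      ∀ θ : FOForm (σ ⊕ Unit) (exAr ar n) (OptIter m Empty),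
        FOForm.isQF (OptIter m Empty) θ →
        Rewrites (FOForm.allIter m θ) φ → KCoherent (m ^ n) φ) := by
  exact ⟨coherent_of_rewritable φ hφ, fun m _ θ hθ hr => kcoherent_of_univ φ m θ hθ hr⟩
end

section
/- Let τ be a relational vocabulary, φ a ∀D(τ)-formula, and k ≥ 1. Then φ is k-coherent if and only if φ is k-coherent in the finite. -/
/-- Satisfaction of `∃`-free formulas is inherited by subteams of substructures. -/
theorem depSat_pullback {σ : Type} {ar : σ → ℕ} {A B : Type} (M : DepStr σ ar A)
    (N : DepStr σ ar B) (f : B → A) (hf : Function.Injective f)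
    (hrel : ∀ r v, N.rel r v ↔ M.rel r (fun i => f (v i)))
    {V : Type} (φ : DepFormula σ ar V) (hφ : DepFormula.noEx V φ)
    (T : Set (V → A)) (S : Set (V → B)) (hST : ∀ s ∈ S, (fun v => f (s v)) ∈ T)
    (h : DepSat M V φ T) : DepSat N V φ S := by
  induction φ with
  | rel r ts => exact fun s hs => (hrel _ _).2 (h _ (hST s hs))
  | nrel r ts => exact fun s hs hr => h _ (hST s hs) ((hrel _ _).1 hr)
  | eq x y => exact fun s hs => hf (h _ (hST s hs))
  | neq x y => exact fun s hs he => h _ (hST s hs) (congrArg f he)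
  | dep m ys z =>
    exact fun s₁ h₁ s₂ h₂ he =>
      hf (h _ (hST s₁ h₁) _ (hST s₂ h₂) fun i => congrArg f (he i))
  | and φ ψ ih₁ ih₂ => exact ⟨ih₁ hφ.1 T S hST h.1, ih₂ hφ.2 T S hST h.2⟩
  | or φ ψ ih₁ ih₂ =>
    obtain ⟨T₁, T₂, rfl, h₁, h₂⟩ := h
    refine ⟨{s ∈ S | (fun v => f (s v)) ∈ T₁}, {s ∈ S | (fun v => f (s v)) ∈ T₂}, ?_,
      ih₁ hφ.1 T₁ _ (fun s hs => hs.2) h₁, ih₂ hφ.2 T₂ _ (fun s hs => hs.2) h₂⟩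
    ext s
    constructor
    · intro hs
      exact (hST s hs).imp (fun h => ⟨hs, h⟩) (fun h => ⟨hs, h⟩)
    · rintro (hs | hs) <;> exact hs.1
  | all φ ih => exact ih hφ _ _ (fun s hs => hST _ hs) h
  | ex φ ih => exact hφ.elim

/-- Compactness: an `∃`-free formula true in all finite substructures (along an ultrafilter
of finite subsets) holds of any limit team. -/
theorem depSat_limit {σ : Type} {ar : σ → ℕ} {A : Type} (M : DepStr σ ar A)
    (U : Ultrafilter (Finset A)) (hU : ∀ a, ∀ᶠ B : Finset A in (U : Filter (Finset A)), a ∈ B)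
    {V : Type} (φ : DepFormula σ ar V) (hφ : DepFormula.noEx V φ)
    (F : ∀ B : Finset A, Set (V → (B : Set A))) (T : Set (V → A))
    (hT : ∀ s ∈ T, ∀ᶠ B : Finset A in (U : Filter (Finset A)), ∃ t ∈ F B, s = fun v => (t v : A))
    (h : ∀ᶠ B : Finset A in (U : Filter (Finset A)), DepSat (M.sub (B : Set A)) V φ (F B)) :
    DepSat M V φ T := by
  induction φ with
  | rel r ts =>
    intro s hs
    obtain ⟨B, ⟨t, ht, rfl⟩, hB⟩ := ((hT s hs).and h).exists
    exact hB t ht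
  | nrel r ts =>
    intro s hs
    obtain ⟨B, ⟨t, ht, rfl⟩, hB⟩ := ((hT s hs).and h).exists
    exact hB t ht
  | eq x y =>
    intro s hs
    obtain ⟨B, ⟨t, ht, rfl⟩, hB⟩ := ((hT s hs).and h).exists
    exact congrArg Subtype.val (hB t ht)
  | neq x y =>
    intro s hs
    obtain ⟨B, ⟨t, ht, rfl⟩, hB⟩ := ((hT s hs).and h).exists
    exact fun he => hB t ht (Subtype.ext he)
  | dep m ys z =>
    intro s₁ h₁ s₂ h₂ he
    obtain ⟨B, ⟨⟨t₁, ht₁, rfl⟩, ⟨t₂, ht₂, rfl⟩⟩, hB⟩ :=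
      (((hT s₁ h₁).and (hT s₂ h₂)).and h).exists
    exact congrArg Subtype.val (hB t₁ ht₁ t₂ ht₂ fun i => Subtype.ext (he i))
  | and φ ψ ih₁ ih₂ =>
    exact ⟨ih₁ hφ.1 F T hT (h.mono fun _ hB => hB.1), ih₂ hφ.2 F T hT (h.mono fun _ hB => hB.2)⟩
  | or φ ψ ih₁ ih₂ =>
    have hc : ∀ B : Finset A, ∃ P : Set (_ → (B : Set A)) × Set (_ → (B : Set A)),
        DepSat (M.sub (B : Set A)) _ (.or φ ψ) (F B) →
          F B = P.1 ∪ P.2 ∧ DepSat (M.sub (B : Set A)) _ φ P.1 ∧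
            DepSat (M.sub (B : Set A)) _ ψ P.2 := by
      intro B
      by_cases hB : DepSat (M.sub (B : Set A)) _ (.or φ ψ) (F B)
      · obtain ⟨T₁, T₂, hh⟩ := hB
        exact ⟨(T₁, T₂), fun _ => hh⟩
      · exact ⟨(∅, ∅), fun hh => (hB hh).elim⟩
    choose P hP using hc
    refine ⟨{s ∈ T | ∀ᶠ B : Finset A in (U : Filter (Finset A)), ∃ t ∈ (P B).1, s = fun v => (t v : A)},
      {s ∈ T | ∀ᶠ B : Finset A in (U : Filter (Finset A)), ∃ t ∈ (P B).2, s = fun v => (t v : A)}, ?_,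
      ih₁ hφ.1 (fun B => (P B).1) _ (fun s hs => hs.2) (h.mono fun B hB => (hP B hB).2.1),
      ih₂ hφ.2 (fun B => (P B).2) _ (fun s hs => hs.2) (h.mono fun B hB => (hP B hB).2.2)⟩
    ext s
    constructor
    · intro hs
      have : ∀ᶠ B : Finset A in (U : Filter (Finset A)), (∃ t ∈ (P B).1, s = fun v => (t v : A)) ∨
          (∃ t ∈ (P B).2, s = fun v => (t v : A)) := by
        filter_upwards [hT s hs, h] with B ⟨t, ht, hst⟩ hB
        rw [(hP B hB).1] at ht
        exact ht.imp (fun h => ⟨t, h, hst⟩) (fun h => ⟨t, h, hst⟩)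
      exact (Ultrafilter.eventually_or.1 this).imp (fun h => ⟨hs, h⟩) (fun h => ⟨hs, h⟩)
    · rintro (hs | hs) <;> exact hs.1
  | all φ ih =>
    refine ih hφ (fun B => {s | (fun v => s (some v)) ∈ F B}) _ ?_ h
    intro s hs
    filter_upwards [hT _ hs, hU (s none)] with B ⟨t, ht, hst⟩ hB
    refine ⟨fun o => Option.elim o ⟨s none, hB⟩ t, ht, ?_⟩
    funext o
    cases o with
    | none => rfl
    | some v => exact congrFun hst v
  | ex φ ih => exact hφ.elim

/-- For an `∃`-free dependence formula `φ(x₁,…,xₙ)` and `k ≥ 1`: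
`φ` is `k`-coherent iff `φ` is `k`-coherent in the finite. -/
theorem stmt6 {σ : Type} {ar : σ → ℕ} {n : ℕ}
    (φ : DepFormula σ ar (Fin n)) (hφ : DepFormula.noEx (Fin n) φ)
    (k : ℕ) (hk : 1 ≤ k) :
    KCoherent k φ ↔ KCoherentFin k φ := by
  constructor
  · intro h A _ _ M T
    exact h A M T
  intro h A _ M T
  constructor
  · intro hT S hS _ _
    exact depSat_pullback M M id Function.injective_id (fun _ _ => Iff.rfl) φ hφ T S
      (fun s hs => hS hs) hT
  intro hS
  classical
  let U : Ultrafilter (Finset A) := Ultrafilter.of Filter.atTop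
  have hU : ∀ a, ∀ᶠ B : Finset A in (U : Filter (Finset A)), a ∈ B := by
    intro a
    apply Ultrafilter.of_le Filter.atTop
    filter_upwards [Filter.eventually_ge_atTop ({a} : Finset A)] with B hB
    exact hB (Finset.mem_singleton_self a)
  refine depSat_limit M U hU φ hφ (fun B => teamRestrict T (B : Set A)) T ?_ ?_
  · intro s hs
    have : ∀ᶠ B : Finset A in (U : Filter (Finset A)), ∀ i, s i ∈ B :=
      Filter.eventually_all.2 fun i => hU (s i)
    filter_upwards [this] with B hB
    exact ⟨fun i => ⟨s i, hB i⟩, hs, rfl⟩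
  · obtain ⟨a⟩ := ‹Nonempty A›
    filter_upwards [hU a] with B hB
    have : Nonempty (B : Set A) := ⟨⟨a, hB⟩⟩
    refine (h (B : Set A) (M.sub (B : Set A)) (teamRestrict T (B : Set A))).2 ?_
    intro S hST hfin hcard
    refine depSat_pullback M (M.sub (B : Set A)) Subtype.val Subtype.val_injective
      (fun _ _ => Iff.rfl) φ hφ (Set.image (fun s v => (s v : A)) S) S
      (fun s hs => ⟨s, hs, rfl⟩) (hS _ ?_ (hfin.image _) ?_)
    · rintro _ ⟨s, hs, rfl⟩
      exact hST hs
    · exact (Set.ncard_image_le hfin).trans hcard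
end
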